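/- If two symbolic matrix bisystems satisfying FPCC are properly strong shift equivalent (i.e. joined by a finite chain of properly strong shift equivalences in 1-step through symbolic matrix bisystems), then their presenting subshifts are topologically conjugate. -/

import Mathlib

/-- The shift homeomorphism `σ` on the full shift: `(σ x) n = x (n+1)`. -/
def shiftMap {A : Type} (x : ℤ → A) : ℤ → A := fun n => x (n + 1)

/-- A subshift: a closed, shift-invariant subset of the full shift `A^ℤ`
(with `A` carrying the discrete topology and `A^ℤ` the product topology). -/
def IsSubshift {A : Type} [TopologicalSpace A] (Λ : Set (ℤ → A)) : Prop :=
  IsClosed Λ ∧ shiftMap '' Λ = Λ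

/-- Replace the coordinates strictly between `k` and `l` of `x` by those of `μ`. -/
def splice {A : Type} (x : ℤ → A) (k l : ℤ) (μ : ℤ → A) : ℤ → A :=
  fun n => if k < n ∧ n < l then μ n else x n

/-- `W_{k,l}(x)`: the set of words (recorded on the coordinates strictly between `k`
and `l`) which can be inserted between `x_{(-∞,k]}` and `x_{[l,∞)}` inside `Λ`. -/
def WSet {A : Type} (Λ : Set (ℤ → A)) (k l : ℤ) (x : ℤ → A) : Set (ℤ → A) :=
  { μ | splice x k l μ ∈ Λ }
/-- The set of (nonempty) admissible words of a subshift. -/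
def lang {A : Type} (Λ : Set (ℤ → A)) : Set (List A) :=
  { w | w ≠ [] ∧ ∃ x ∈ Λ, ∃ i : ℤ, ∀ j : Fin w.length, w.get j = x (i + (j : ℕ)) }
/-- Topological conjugacy of two subshifts: a shift-commuting homeomorphism. -/
def TopConj {A B : Type} [TopologicalSpace A] [TopologicalSpace B]
    (Λ₁ : Set (ℤ → A)) (Λ₂ : Set (ℤ → B)) : Prop :=
  ∃ h : ↥Λ₁ ≃ₜ ↥Λ₂,
    ∀ (x : ℤ → A) (hx : x ∈ Λ₁) (hx' : shiftMap x ∈ Λ₁),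
      (h ⟨shiftMap x, hx'⟩).1 = shiftMap (h ⟨x, hx⟩).1
/-- Product of two symbolic matrices: the entries of the product of a symbolic matrix
over `C` and a symbolic matrix over `D` are formal sums (multisets) of two-letter
words in `C·D`. -/
def symMul {I J K C D : Type} [Fintype J]
    (A : I → J → Multiset C) (B : J → K → Multiset D) : I → K → Multiset (C × D) :=
  fun i k => ∑ j : J, (A i j).bind fun a => (B j k).map fun b => (a, b)
/-- The underlying data of a symbolic matrix bisystem: sequences of `m l × m (l+1)`
symbolic matrices (entries are formal sums, i.e. multisets, of symbols). -/
structure SMBData (Sm Sp : Type) where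
  m : ℕ → ℕ
  Mm : ∀ l, Fin (m l) → Fin (m (l + 1)) → Multiset Sm
  Mp : ∀ l, Fin (m l) → Fin (m (l + 1)) → Multiset Sp

/-- The axioms making the data `M` a symbolic matrix bisystem: nonzero rows and
columns, no repeated symbol in an entry, no symbol repeated across the rows of a
column (right/left resolving), and the κ-commutation relation
`M⁻_{l,l+1} M⁺_{l+1,l+2} ≃_κ M⁺_{l,l+1} M⁻_{l+1,l+2}`. -/
structure IsSMB {Sm Sp : Type} (M : SMBData Sm Sp) : Prop where
  mpos : ∀ l, 0 < M.m l
  row_m : ∀ l i, ∃ j, M.Mm l i j ≠ 0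
  col_m : ∀ l j, ∃ i, M.Mm l i j ≠ 0
  row_p : ∀ l i, ∃ j, M.Mp l i j ≠ 0
  col_p : ∀ l j, ∃ i, M.Mp l i j ≠ 0
  nodup_m : ∀ l i j, (M.Mm l i j).Nodup
  nodup_p : ∀ l i j, (M.Mp l i j).Nodup
  res_m : ∀ l j i i' a, a ∈ M.Mm l i j → a ∈ M.Mm l i' j → i = i'
  res_p : ∀ l j i i' a, a ∈ M.Mp l i j → a ∈ M.Mp l i' j → i = i'
  commute : ∀ l i j,
    (symMul (M.Mm l) (M.Mp (l + 1)) i j).map Prod.swap = symMul (M.Mp l) (M.Mm (l + 1)) i j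

/-- Entries of the product of `k` consecutive symbolic matrices starting at level `n`:
formal sums of words of length `k`. -/
def prodFrom {S : Type} {m : ℕ → ℕ}
    (M : ∀ l, Fin (m l) → Fin (m (l + 1)) → Multiset S) (n : ℕ) :
    (k : ℕ) → Fin (m n) → Fin (m (n + k)) → Multiset (List S)
  | 0, i, j => if i = j then {[]} else 0
  | k + 1, i, j =>
      ∑ p : Fin (m (n + k)),
        (prodFrom M n k i p).bind fun w => (M (n + k) p j).map fun a => w ++ [a]

/-- FPCC for a symbolic matrix bisystem over a common alphabet: it is standard
(`m 0 = 1`) and for every `l ≥ 1` the words appearing in the `(1,j)` entry of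
`M⁻_{0,1}⋯M⁻_{l-1,l}` are exactly the reversed words appearing in the `(1,j)` entry
of `M⁺_{0,1}⋯M⁺_{l-1,l}`. -/
def SMBData.FPCC {S : Type} (M : SMBData S S) : Prop :=
  M.m 0 = 1 ∧
  ∀ l : ℕ, 1 ≤ l → ∀ (i : Fin (M.m 0)) (j : Fin (M.m (0 + l))) (w : List S),
    w ∈ prodFrom M.Mm 0 l i j ↔ w.reverse ∈ prodFrom M.Mp 0 l i j

/-- The set of nonempty admissible words of the presenting subshift of a symbolic
matrix bisystem: the words appearing as entries of products
`M⁺_{l,l+1} M⁺_{l+1,l+2} ⋯ M⁺_{l+k-1,l+k}`. -/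
def smbWords {S : Type} (M : SMBData S S) : Set (List S) :=
  { w | w ≠ [] ∧ ∃ (n k : ℕ) (i : Fin (M.m n)) (j : Fin (M.m (n + k))),
      w ∈ prodFrom M.Mp n k i j }
/-- The data of a properly strong shift equivalence in 1-step between two symbolic
matrix bisystems `M` (over `Σ_M`) and `N` (over `Σ_N`), with alphabets `C, D`,
specifications `φ : Σ_M → C·D`, `ψ : Σ_N → D·C`, and matrices `P_l` over `C`, `Q_l`
over `D`, `X_l` over `D` and `Y_l` over `C` (the parity-dependent families `X, Y`
are recorded as `Xe l = X_{2l}`, `Xo l = X_{2l+1}`, `Ye l = Y_{2l}`, `Yo l = Y_{2l+1}`),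
subject to the defining specified equivalences. -/
structure PSSE1Data (C D : Type) {SM SN : Type} (M : SMBData SM SM) (N : SMBData SN SN) where
  φ : SM → C × D
  ψ : SN → D × C
  φ_inj : Function.Injective φ
  ψ_inj : Function.Injective ψ
  c : ℕ → ℕ
  d : ℕ → ℕ
  hc : ∀ l, c (2 * l) = M.m l
  hd : ∀ l, d (2 * l) = N.m l
  P : ∀ l, Fin (c l) → Fin (d (l + 1)) → Multiset C
  Q : ∀ l, Fin (d l) → Fin (c (l + 1)) → Multiset D
  Xe : ∀ l, Fin (c (2 * l)) → Fin (c (2 * l + 1)) → Multiset D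
  Xo : ∀ l, Fin (d (2 * l + 1)) → Fin (d (2 * l + 2)) → Multiset D
  Ye : ∀ l, Fin (d (2 * l)) → Fin (d (2 * l + 1)) → Multiset C
  Yo : ∀ l, Fin (c (2 * l + 1)) → Fin (c (2 * l + 2)) → Multiset C
  hMp : ∀ l i j, (M.Mp l i j).map φ =
    symMul (P (2 * l)) (Q (2 * l + 1)) (Fin.cast (hc l).symm i) (Fin.cast (hc (l + 1)).symm j)
  hNp : ∀ l i j, (N.Mp l i j).map ψ =
    symMul (Q (2 * l)) (P (2 * l + 1)) (Fin.cast (hd l).symm i) (Fin.cast (hd (l + 1)).symm j)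
  hMm : ∀ l i j, (M.Mm l i j).map (Prod.swap ∘ φ) =
    symMul (Xe l) (Yo l) (Fin.cast (hc l).symm i) (Fin.cast (hc (l + 1)).symm j)
  hNm : ∀ l i j, (N.Mm l i j).map (Prod.swap ∘ ψ) =
    symMul (Ye l) (Xo l) (Fin.cast (hd l).symm i) (Fin.cast (hd (l + 1)).symm j)
  hYP : ∀ l i j, (symMul (Yo l) (P (2 * l + 2)) i j).map Prod.swap =
    symMul (P (2 * l + 1)) (Ye (l + 1)) i j
  hXQ : ∀ l i j, (symMul (Xo l) (Q (2 * l + 2)) i j).map Prod.swap =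
    symMul (Q (2 * l + 1)) (Xe (l + 1)) i j
  hXP : ∀ l i j, (symMul (Xe l) (P (2 * l + 1)) i j).map Prod.swap =
    symMul (P (2 * l)) (Xo l) i j
  hYQ : ∀ l i j, (symMul (Ye l) (Q (2 * l + 1)) i j).map Prod.swap =
    symMul (Q (2 * l)) (Yo l) i j

/-- Properly strong shift equivalence in 1-step. -/
def PSSE1 {SM SN : Type} (M : SMBData SM SM) (N : SMBData SN SN) : Prop :=
  ∃ C D : Type, Nonempty (PSSE1Data C D M N)
/-- A symbolic matrix bisystem over a common alphabet, satisfying FPCC (bundled). -/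
structure SMBBundle : Type 1 where
  carrier : Type
  data : SMBData carrier carrier
  isSMB : IsSMB data
  fpcc : data.FPCC

/-- Properly strong shift equivalence: a finite chain of symbolic matrix bisystems
each consecutive pair of which is properly strong shift equivalent in 1-step. -/
def ProperlySSE (b b' : SMBBundle) : Prop :=
  Relation.ReflTransGen (fun u v : SMBBundle => PSSE1 u.data v.data) b b'

theorem mem_symMul {I J K C D : Type} [Fintype J] {A : I → J → Multiset C}
    {B : J → K → Multiset D} {i : I} {k : K} {a : C} {b : D} :
    (a, b) ∈ symMul A B i k ↔ ∃ j, a ∈ A i j ∧ b ∈ B j k := by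
  simp [symMul, Multiset.mem_sum]

theorem mem_symMul_of_swap_eq {I J J' K C D : Type} [Fintype J] [Fintype J']
    {A : I → J → Multiset C} {B : J → K → Multiset D}
    {B' : I → J' → Multiset D} {A' : J' → K → Multiset C} {i : I} {k : K}
    (h : (symMul A B i k).map Prod.swap = symMul B' A' i k) {j : J} {a : C} {b : D}
    (ha : a ∈ A i j) (hb : b ∈ B j k) : ∃ j', b ∈ B' i j' ∧ a ∈ A' j' k := by
  rw [← mem_symMul, ← h]
  exact Multiset.mem_map.2 ⟨(a, b), mem_symMul.2 ⟨j, ha, hb⟩, rfl⟩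

theorem length_of_mem_prodFrom {S : Type} {m : ℕ → ℕ}
    {M : ∀ l, Fin (m l) → Fin (m (l + 1)) → Multiset S} {n k : ℕ} {i : Fin (m n)}
    {j : Fin (m (n + k))} {w : List S} (hw : w ∈ prodFrom M n k i j) : w.length = k := by
  induction k generalizing w with
  | zero =>
    rw [prodFrom] at hw
    split_ifs at hw <;> simp_all
  | succ k ih =>
    simp only [prodFrom, Multiset.mem_sum, Multiset.mem_bind, Multiset.mem_map] at hw
    obtain ⟨p, -, w', hw', a, -, rfl⟩ := hw
    simp [ih hw']

/-- A word lies in an entry of a product iff it labels a path between the two vertices. -/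
theorem ofFn_mem_prodFrom_iff {S : Type} {m : ℕ → ℕ} (hm : ∀ l, 0 < m l)
    {M : ∀ l, Fin (m l) → Fin (m (l + 1)) → Multiset S} (x : ℕ → S) {n k : ℕ} {i : Fin (m n)}
    {j : Fin (m (n + k))} :
    List.ofFn (fun t : Fin k => x t) ∈ prodFrom M n k i j ↔
      ∃ v : ∀ t, Fin (m t), v n = i ∧ v (n + k) = j ∧
        ∀ t < k, x t ∈ M (n + t) (v (n + t)) (v (n + t + 1)) := by
  induction k with
  | zero =>
    simp only [prodFrom, List.ofFn_zero]
    constructor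
    · intro h
      split_ifs at h with hij
      · exact ⟨Function.update (fun t => ⟨0, hm t⟩) n i, by simp, by subst hij; simp, by simp⟩
      · simp at h
    · rintro ⟨v, rfl, rfl, -⟩
      simp
  | succ k ih =>
    simp only [prodFrom, Multiset.mem_sum, Multiset.mem_bind, Multiset.mem_map,
      List.ofFn_succ_last, Fin.val_castSucc, Fin.val_last]
    constructor
    · rintro ⟨p, -, w, hw, a, ha, hwa⟩
      obtain ⟨rfl, h2⟩ := List.append_inj' hwa rfl
      obtain rfl : a = x k := by simpa using h2
      obtain ⟨v, h1, rfl, h3⟩ := ih.1 hw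
      have hne : ∀ t, t ≤ n + k → Function.update v (n + (k + 1)) j t = v t := fun t ht =>
        Function.update_of_ne (by omega) _ _
      refine ⟨Function.update v (n + (k + 1)) j, ?_, by simp, fun t ht => ?_⟩
      · rw [hne _ (by omega), h1]
      · rw [hne _ (by omega)]
        rcases Nat.lt_succ_iff_lt_or_eq.1 ht with ht | rfl
        · rw [hne _ (by omega)]
          exact h3 t ht
        · exact (Function.update_self (n + (t + 1)) j v).symm ▸ ha
    · rintro ⟨v, h1, rfl, h3⟩
      exact ⟨v (n + k), Finset.mem_univ _, _,
        ih.2 ⟨v, h1, rfl, fun t ht => h3 t (by omega)⟩, x k, h3 k (by omega), rfl⟩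

/-- The bi-infinite sequences all of whose finite blocks label paths of the `λ`-graph system
of `M⁺`. The level `0` is placed at the coordinate `z`. -/
def pathShift {S : Type} (M : SMBData S S) : Set (ℤ → S) :=
  {x | ∀ a b : ℤ, ∃ z ≤ a, ∃ v : ∀ t, Fin (M.m t), ∀ s : ℕ, a ≤ z + s → z + s < b →
    x (z + s) ∈ M.Mp s (v s) (v (s + 1))}

theorem comp_add_mem_pathShift {S : Type} {M : SMBData S S} {x : ℤ → S} (hx : x ∈ pathShift M)
    (c : ℤ) : (fun n => x (n + c)) ∈ pathShift M := by
  intro a b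
  obtain ⟨z, hz, v, hv⟩ := hx (a + c) (b + c)
  refine ⟨z - c, by omega, v, fun s h1 h2 => ?_⟩
  have := hv s (by omega) (by omega)
  rwa [← show z - c + s + c = z + s by ring] at this

theorem mem_pathShift_iff {S : Type} {M : SMBData S S} (hM : IsSMB M) {x : ℤ → S} :
    x ∈ pathShift M ↔
      ∀ (i : ℤ) (k : ℕ), List.ofFn (fun t : Fin (k + 1) => x (i + (t : ℕ))) ∈ smbWords M := by
  constructor
  · intro hx i k
    obtain ⟨z, hz, v, hv⟩ := hx i (i + (k + 1))
    obtain ⟨n, hn⟩ := Int.eq_ofNat_of_zero_le (sub_nonneg.2 hz)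
    refine ⟨by simp, n, k + 1, v n, v (n + (k + 1)), ?_⟩
    refine (ofFn_mem_prodFrom_iff hM.mpos (fun t => x (i + t))).2 ⟨v, rfl, rfl, fun t ht => ?_⟩
    have := hv (n + t) (by push_cast; omega) (by push_cast; omega)
    rwa [show z + ((n + t : ℕ) : ℤ) = i + t by push_cast; omega] at this
  · intro hx a b
    obtain ⟨-, n, k, i, j, hw⟩ := hx a (b - a).toNat
    obtain rfl : (b - a).toNat + 1 = k := by simpa using length_of_mem_prodFrom hw
    obtain ⟨v, -, -, hv⟩ := (ofFn_mem_prodFrom_iff hM.mpos (fun t => x (a + t))).1 hw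
    refine ⟨a - n, by omega, v, fun s h1 h2 => ?_⟩
    obtain ⟨t, rfl⟩ := Nat.exists_eq_add_of_le (show n ≤ s by omega)
    have := hv t (by omega)
    rwa [show a - n + ((n + t : ℕ) : ℤ) = a + t by push_cast; ring]

theorem comp_add_mem_of_shiftMap_image_eq {S : Type} {Λ : Set (ℤ → S)}
    (h : shiftMap '' Λ = Λ) {x : ℤ → S} (hx : x ∈ Λ) (c : ℤ) : (fun n => x (n + c)) ∈ Λ := by
  induction c with
  | zero => simpa using hx
  | succ c ih =>
    rw [← h]
    refine ⟨_, ih, funext fun n => ?_⟩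
    simp only [shiftMap]
    congr 1
    ring
  | pred c ih =>
    rw [← h] at ih
    obtain ⟨y, hy, hyx⟩ := ih
    convert hy using 1
    funext n
    have := congrFun hyx (n - 1)
    simp only [shiftMap, sub_add_cancel] at this
    rw [this]
    congr 1
    ring

/-- A subshift is determined by its language. -/
theorem IsSubshift.mem_of_forall_ofFn_mem_lang {S : Type} [TopologicalSpace S]
    [DiscreteTopology S] {Λ : Set (ℤ → S)} (hΛ : IsSubshift Λ) {x : ℤ → S}
    (hx : ∀ (i : ℤ) (k : ℕ), List.ofFn (fun t : Fin (k + 1) => x (i + (t : ℕ))) ∈ lang Λ) :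
    x ∈ Λ := by
  rw [← hΛ.1.closure_eq, mem_closure_iff_nhds]
  intro U hU
  rw [nhds_pi, Filter.mem_pi] at hU
  obtain ⟨I, hI, t, ht, hIU⟩ := hU
  obtain ⟨r, hr⟩ : ∃ r : ℕ, ∀ n ∈ I, n.natAbs ≤ r :=
    (hI.image Int.natAbs).bddAbove.imp fun r hr n hn => hr ⟨n, hn, rfl⟩
  obtain ⟨-, y, hy, i, hyi⟩ := hx (-r) (2 * r)
  refine ⟨fun n => y (n + (i + r)), hIU fun n hn => ?_,
    comp_add_mem_of_shiftMap_image_eq hΛ.2 hy _⟩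
  have hn' := hr n hn
  have := hyi ⟨(n + r).toNat, by rw [List.length_ofFn]; omega⟩
  simp only [List.get_eq_getElem, List.getElem_ofFn] at this
  rw [show (-r + ((n + r).toNat : ℕ) : ℤ) = n by omega,
    show (i + ((n + r).toNat : ℕ) : ℤ) = n + (i + r) by omega] at this
  simp only [← this]
  exact mem_of_mem_nhds (ht n)

theorem eq_pathShift_of_lang_eq {S : Type} [TopologicalSpace S] [DiscreteTopology S]
    {M : SMBData S S} (hM : IsSMB M) {Λ : Set (ℤ → S)} (hΛ : IsSubshift Λ)
    (hL : lang Λ = smbWords M) : Λ = pathShift M := by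
  ext x
  rw [mem_pathShift_iff hM, ← hL]
  refine ⟨fun hx i k => ⟨by simp, x, hx, i, fun j => by
    rw [List.get_eq_getElem, List.getElem_ofFn]⟩, hΛ.mem_of_forall_ofFn_mem_lang⟩

theorem TopConj.refl {A : Type} [TopologicalSpace A] (Λ : Set (ℤ → A)) : TopConj Λ Λ :=
  ⟨Homeomorph.refl _, fun _ _ _ => rfl⟩

theorem TopConj.trans {A B C : Type} [TopologicalSpace A] [TopologicalSpace B]
    [TopologicalSpace C] {Λ₁ : Set (ℤ → A)} {Λ₂ : Set (ℤ → B)} {Λ₃ : Set (ℤ → C)}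
    (h₁ : TopConj Λ₁ Λ₂) (h₂ : TopConj Λ₂ Λ₃) : TopConj Λ₁ Λ₃ := by
  obtain ⟨f, hf⟩ := h₁
  obtain ⟨g, hg⟩ := h₂
  refine ⟨f.trans g, fun x hx hx' => ?_⟩
  have h := hf x hx hx'
  have h' : shiftMap (f ⟨x, hx⟩).1 ∈ Λ₂ := h ▸ (f ⟨shiftMap x, hx'⟩).2
  have e : f ⟨shiftMap x, hx'⟩ = ⟨shiftMap (f ⟨x, hx⟩).1, h'⟩ := Subtype.ext h
  simpa [e] using hg _ (f ⟨x, hx⟩).2 h'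

theorem continuous_of_eq_of_eq_on_finite {A B : Type} [TopologicalSpace A] [DiscreteTopology A]
    [TopologicalSpace B] [DiscreteTopology B] {Λ : Set (ℤ → A)} {f : Λ → ℤ → B} (I : ℤ → Finset ℤ)
    (hf : ∀ n x y, (∀ i ∈ I n, x.1 i = y.1 i) → f x n = f y n) : Continuous f := by
  refine continuous_pi fun n => continuous_iff_continuousAt.2 fun x => ?_
  rw [ContinuousAt, nhds_discrete B, Filter.tendsto_pure]
  have : ∀ᶠ y : Λ in nhds x, ∀ i ∈ I n, y.1 i = x.1 i := by
    rw [Filter.eventually_all_finset]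
    intro i _
    have hc : Continuous fun y : Λ => y.1 i :=
      (continuous_apply i).comp continuous_subtype_val
    have := hc.continuousAt (x := x)
    rwa [ContinuousAt, nhds_discrete A, Filter.tendsto_pure] at this
  filter_upwards [this] with y hy
  exact hf n y x hy

/-- Two sequences determining each other through local rules give conjugate shifts. -/
theorem topConj_of_relation {A B : Type} [TopologicalSpace A] [DiscreteTopology A]
    [TopologicalSpace B] [DiscreteTopology B] {C D : Type} {Λ₁ : Set (ℤ → A)} {Λ₂ : Set (ℤ → B)}
    {φ : A → C × D} {ψ : B → D × C} (hφ : Function.Injective φ) (hψ : Function.Injective ψ)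
    (h₁ : ∀ x ∈ Λ₁, ∃ y ∈ Λ₂, ∀ n, ψ (y n) = ((φ (x n)).2, (φ (x (n + 1))).1))
    (h₂ : ∀ y ∈ Λ₂, ∃ x ∈ Λ₁, ∀ n, φ (x n) = ((ψ (y (n - 1))).2, (ψ (y n)).1)) :
    TopConj Λ₁ Λ₂ := by
  choose F hF hF' using h₁
  choose G hG hG' using h₂
  refine ⟨⟨⟨fun x => ⟨F x.1 x.2, hF _ _⟩, fun y => ⟨G y.1 y.2, hG _ _⟩, fun x => ?_, fun y => ?_⟩,
    ?_, ?_⟩, fun x hx hx' => ?_⟩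
  · refine Subtype.ext (funext fun n => hφ ?_)
    simp [hG', hF']
  · refine Subtype.ext (funext fun n => hψ ?_)
    simp [hG', hF']
  · refine Continuous.subtype_mk (continuous_of_eq_of_eq_on_finite (fun n => {n, n + 1}) ?_) _
    intro n x y h
    apply hψ
    simp only [hF', h n (by simp), h (n + 1) (by simp)]
  · refine Continuous.subtype_mk (continuous_of_eq_of_eq_on_finite (fun n => {n, n - 1}) ?_) _
    intro n x y h
    apply hφ
    simp only [hG', h n (by simp), h (n - 1) (by simp)]
  · refine funext fun n => hψ ?_
    change ψ (F _ hx' n) = ψ (F _ hx (n + 1))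
    rw [hF', hF']
    rfl

namespace PSSE1Data

variable {C D SM SN : Type} {M : SMBData SM SM} {N : SMBData SN SN}

/-- Exchanging the roles of `M` and `N`. -/
def symm (E : PSSE1Data C D M N) : PSSE1Data D C N M where
  φ := E.ψ
  ψ := E.φ
  φ_inj := E.ψ_inj
  ψ_inj := E.φ_inj
  c := E.d
  d := E.c
  hc := E.hd
  hd := E.hc
  P := E.Q
  Q := E.P
  Xe := E.Ye
  Xo := E.Yo
  Ye := E.Xe
  Yo := E.Xo
  hMp := E.hNp
  hNp := E.hMp
  hMm := E.hNm
  hNm := E.hMm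
  hYP := E.hXQ
  hXQ := E.hYP
  hXP := E.hYQ
  hYQ := E.hXP

theorem exists_mem_Yo (E : PSSE1Data C D M N) (hM : IsSMB M) (s : ℕ) (v : Fin (M.m (s + 1))) :
    ∃ p, ∃ y, y ∈ E.Yo s p (Fin.cast (E.hc (s + 1)).symm v) := by
  obtain ⟨i, hi⟩ := hM.col_m s v
  obtain ⟨a, ha⟩ := Multiset.exists_mem_of_ne_zero hi
  have := Multiset.mem_map_of_mem (Prod.swap ∘ E.φ) ha
  rw [E.hMm] at this
  obtain ⟨p, -, hp⟩ := mem_symMul.1 this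
  exact ⟨p, _, hp⟩

/-- Pushing an edge of `Y` past one edge of `M⁺`. -/
theorem exists_ladder_step (E : PSSE1Data C D M N) {s : ℕ} {p : Fin (E.c (2 * s + 1))}
    {v : Fin (M.m (s + 1))} {v' : Fin (M.m (s + 1 + 1))} {y : C} {a : SM}
    (hy : y ∈ E.Yo s p (Fin.cast (E.hc (s + 1)).symm v)) (ha : a ∈ M.Mp (s + 1) v v') :
    ∃ (q : Fin (E.d (2 * s + 1 + 1))) (p' : Fin (E.c (2 * (s + 1) + 1))),
      (E.φ a).1 ∈ E.P (2 * s + 1) p q ∧ (E.φ a).2 ∈ E.Q (2 * (s + 1)) q p' ∧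
        y ∈ E.Yo (s + 1) p' (Fin.cast (E.hc (s + 1 + 1)).symm v') := by
  have := Multiset.mem_map_of_mem E.φ ha
  rw [E.hMp] at this
  obtain ⟨w, h1, h2⟩ := mem_symMul.1 this
  obtain ⟨q, hq, hy'⟩ := mem_symMul_of_swap_eq (E.hYP s _ _) hy h1
  obtain ⟨p', hp', hy''⟩ := mem_symMul_of_swap_eq (E.hYQ (s + 1) _ _) hy' h2
  exact ⟨q, p', hq, hp', hy''⟩

theorem exists_path_map (E : PSSE1Data C D M N) (hM : IsSMB M) (hN : IsSMB N) {x : ℤ → SM}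
    (hx : x ∈ pathShift M) (a b : ℤ) :
    ∃ z ≤ a, ∃ u : ∀ t, Fin (N.m t), ∀ s : ℕ, a ≤ z + s → z + s < b →
      ((E.φ (x (z + s))).2, (E.φ (x (z + s + 1))).1) ∈
        (N.Mp s (u s) (u (s + 1))).map E.ψ := by
  obtain ⟨z, hz, v, hv⟩ := hx (a - 1) (b + 1)
  let good (s : ℕ) (p : Fin (E.c (2 * s + 1))) : Prop :=
    ∃ y, y ∈ E.Yo s p (Fin.cast (E.hc (s + 1)).symm (v (s + 1)))
  have step : ∀ s (p : {p // good s p}), ∃ (q : Fin (E.d (2 * s + 1 + 1)))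
      (p' : {p // good (s + 1) p}), a ≤ z + (s + 1) → z + (s + 1) ≤ b →
        (E.φ (x (z + (s + 1)))).1 ∈ E.P (2 * s + 1) p q ∧
          (E.φ (x (z + (s + 1)))).2 ∈ E.Q (2 * (s + 1)) q p' := by
    rintro s ⟨p, y, hy⟩
    by_cases h : a ≤ z + (s + 1) ∧ z + (s + 1) ≤ b
    · have := hv (s + 1) (by push_cast; omega) (by push_cast; omega)
      push_cast at this
      obtain ⟨q, p', h1, h2, h3⟩ := E.exists_ladder_step hy this
      exact ⟨q, ⟨p', y, h3⟩, fun _ _ => ⟨h1, h2⟩⟩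
    · obtain ⟨p', hp'⟩ := E.exists_mem_Yo hM (s + 1) (v (s + 1 + 1))
      exact ⟨Fin.cast (E.hd (s + 1)).symm ⟨0, hN.mpos _⟩, ⟨p', hp'⟩,
        fun h1 h2 => absurd ⟨h1, h2⟩ h⟩
  choose q p' hqp using step
  let p : ∀ s, {p // good s p} := fun s => Nat.rec
    ⟨(E.exists_mem_Yo hM 0 (v 1)).choose, (E.exists_mem_Yo hM 0 (v 1)).choose_spec⟩ p' s
  have hp : ∀ s, p (s + 1) = p' s (p s) := fun s => rfl
  let u : ∀ t, Fin (N.m t) := fun t => match t with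
    | 0 => ⟨0, hN.mpos 0⟩
    | s + 1 => Fin.cast (E.hd (s + 1)) (q s (p s))
  refine ⟨z, by omega, u, fun s h1 h2 => ?_⟩
  obtain _ | s := s
  · simp only [Nat.cast_zero, add_zero] at h1
    omega
  · push_cast at h1 h2 ⊢
    have e1 := hqp s (p s) h1 (by omega)
    have e2 := hqp (s + 1) (p (s + 1)) (by push_cast; omega) (by push_cast; omega)
    push_cast at e2
    rw [E.hNp, mem_symMul]
    refine ⟨p (s + 1), ?_, ?_⟩
    · rw [hp]
      exact e1.2
    · rw [← add_assoc] at e2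
      exact e2.1

theorem exists_mem_pathShift (E : PSSE1Data C D M N) (hM : IsSMB M) (hN : IsSMB N) {x : ℤ → SM}
    (hx : x ∈ pathShift M) :
    ∃ y ∈ pathShift N, ∀ n, E.ψ (y n) = ((E.φ (x n)).2, (E.φ (x (n + 1))).1) := by
  have key : ∀ n, ∃ b, E.ψ b = ((E.φ (x n)).2, (E.φ (x (n + 1))).1) := by
    intro n
    obtain ⟨z, hz, u, hu⟩ := E.exists_path_map hM hN hx n (n + 1)
    have := hu (n - z).toNat (by omega) (by omega)
    rw [show z + ((n - z).toNat : ℤ) = n by omega] at this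
    obtain ⟨b, -, hb⟩ := Multiset.mem_map.1 this
    exact ⟨b, hb⟩
  choose y hy using key
  refine ⟨y, fun a b => ?_, hy⟩
  obtain ⟨z, hz, u, hu⟩ := E.exists_path_map hM hN hx a b
  refine ⟨z, hz, u, fun s h1 h2 => ?_⟩
  have := hu s h1 h2
  rwa [← hy, Multiset.mem_map_of_injective E.ψ_inj] at this

theorem topConj_pathShift (E : PSSE1Data C D M N) (hM : IsSMB M) (hN : IsSMB N)
    [TopologicalSpace SM] [DiscreteTopology SM] [TopologicalSpace SN] [DiscreteTopology SN] :
    TopConj (pathShift M) (pathShift N) := by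
  refine topConj_of_relation E.φ_inj E.ψ_inj (fun x hx => E.exists_mem_pathShift hM hN hx)
    fun y hy => ?_
  obtain ⟨x, hx, hxy⟩ := E.symm.exists_mem_pathShift hN hM hy
  refine ⟨_, comp_add_mem_pathShift hx (-1), fun n => ?_⟩
  have := hxy (n + -1)
  rwa [neg_add_cancel_right] at this

end PSSE1Data

theorem ProperlySSE.topConj_pathShift {b b' : SMBBundle} (h : ProperlySSE b b') :
    @TopConj b.carrier b'.carrier ⊥ ⊥ (pathShift b.data) (pathShift b'.data) := by
  induction h with
  | refl => exact @TopConj.refl _ ⊥ _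
  | @tail u v _ huv ih =>
    obtain ⟨C, D, ⟨E⟩⟩ := huv
    let : TopologicalSpace b.carrier := ⊥
    let : TopologicalSpace u.carrier := ⊥
    let : TopologicalSpace v.carrier := ⊥
    have : DiscreteTopology u.carrier := ⟨rfl⟩
    have : DiscreteTopology v.carrier := ⟨rfl⟩
    exact TopConj.trans ih (E.topConj_pathShift u.isSMB v.isSMB)

/-- if two symbolic matrix bisystems satisfying FPCC are properly
strong shift equivalent (joined by a finite chain of 1-step properly strong shift
equivalences through symbolic matrix bisystems), their presenting subshifts are
topologically conjugate. -/
theorem stmt_13 {A B : Type} [Finite A] [Finite B]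
    [TopologicalSpace A] [DiscreteTopology A] [TopologicalSpace B] [DiscreteTopology B]
    (M : SMBData A A) (N : SMBData B B)
    (hMs : IsSMB M) (hMf : M.FPCC) (hNs : IsSMB N) (hNf : N.FPCC)
    (ΛM : Set (ℤ → A)) (ΛN : Set (ℤ → B))
    (hΛM : IsSubshift ΛM) (hLM : lang ΛM = smbWords M)
    (hΛN : IsSubshift ΛN) (hLN : lang ΛN = smbWords N)
    (h : ProperlySSE ⟨A, M, hMs, hMf⟩ ⟨B, N, hNs, hNf⟩) :
    TopConj ΛM ΛN := by
  rw [eq_pathShift_of_lang_eq hMs hΛM hLM, eq_pathShift_of_lang_eq hNs hΛN hLN]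
  have := h.topConj_pathShift
  rwa [← DiscreteTopology.eq_bot (α := A), ← DiscreteTopology.eq_bot (α := B)] at this
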